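/- Let b = ρΦ ∈ C¹_♯(Y_d)^d, where ρ ∈ C¹_♯(Y_d) is nonnegative, not identically zero, and vanishes at some point, and Φ ∈ C¹_♯(Y_d)^d vanishes nowhere; let (ρ_n) ⊂ C¹_♯(Y_d) be positive with ρ ≤ ρ_n, ρ_n → ρ uniformly, and with rotation set of ρ_nΦ a singleton {ζ_n} for each n, and let ζ := lim_n ζ_n (which exists). Then for every invariant probability measure μ ∈ 𝓘_b with ∫_{Y_d} b dμ ≠ 0, one has lim_{t→∞} X(t,x)/t = ζ for μ-almost every x in {ρ > 0}. -/

import Mathlib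

open MeasureTheory Filter Matrix

noncomputable section

/-- A function on `ℝ^d` is `ℤ^d`-periodic. -/
def ZdPeriodic {d : ℕ} {E : Type*} (f : (Fin d → ℝ) → E) : Prop :=
  ∀ (κ : Fin d → ℤ) (x : Fin d → ℝ), f (x + fun i => (κ i : ℝ)) = f x

/-- The unit cube `[0,1)^d`, a fundamental domain for the torus `Y_d = ℝ^d/ℤ^d`. -/
def unitCube (d : ℕ) : Set (Fin d → ℝ) := {x | ∀ i, x i ∈ Set.Ico (0 : ℝ) 1}

/-- `X` is the global flow of the vector field `b`: `∂X/∂t(t,x) = b(X(t,x))`, `X(0,x) = x`. -/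
def IsFlowOf {d : ℕ} (b : (Fin d → ℝ) → (Fin d → ℝ))
    (X : ℝ → (Fin d → ℝ) → (Fin d → ℝ)) : Prop :=
  ∀ x : Fin d → ℝ, X 0 x = x ∧ ∀ t : ℝ, HasDerivAt (fun s => X s x) (b (X t x)) t

/-- A measure `μ` on the torus `Y_d` (identified with a measure on `ℝ^d` carried by the unit
cube) is invariant for the flow `X`: `∫ ψ(X(t,y)) dμ = ∫ ψ dμ` for all `t` and all continuous
`ℤ^d`-periodic `ψ`. -/
def FlowInvariant {d : ℕ} (X : ℝ → (Fin d → ℝ) → (Fin d → ℝ))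
    (μ : Measure (Fin d → ℝ)) : Prop :=
  ∀ (t : ℝ) (ψ : (Fin d → ℝ) → ℝ), Continuous ψ → ZdPeriodic ψ →
    ∫ y, ψ (X t y) ∂μ = ∫ y, ψ y ∂μ

/-- Herman's rotation set `C_b = {∫ b dμ : μ invariant probability measure for the flow}`. -/
def rotationSet {d : ℕ} (b : (Fin d → ℝ) → (Fin d → ℝ))
    (X : ℝ → (Fin d → ℝ) → (Fin d → ℝ)) : Set (Fin d → ℝ) :=
  {ζ | ∃ μ : Measure (Fin d → ℝ), IsProbabilityMeasure μ ∧ μ (unitCube d)ᶜ = 0 ∧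
        FlowInvariant X μ ∧ ζ = ∫ y, b y ∂μ}

/-- The gradient of a scalar function on `ℝ^d`. -/
def grad {d : ℕ} (ψ : (Fin d → ℝ) → ℝ) (y : Fin d → ℝ) : Fin d → ℝ :=
  fun i => fderiv ℝ ψ y (Pi.single i 1)

/-- Coordinatewise fractional part, the projection of `ℝ^d` onto the unit cube. -/
def cubeProj {d : ℕ} (x : Fin d → ℝ) : Fin d → ℝ := fun i => Int.fract (x i)

lemma cubeProj_mem_unitCube {d : ℕ} (x : Fin d → ℝ) : cubeProj x ∈ unitCube d :=
  fun _ => ⟨Int.fract_nonneg _, Int.fract_lt_one _⟩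

lemma cubeProj_add_floor {d : ℕ} (x : Fin d → ℝ) :
    cubeProj x + (fun i => ((⌊x i⌋ : ℤ) : ℝ)) = x :=
  funext fun i => Int.fract_add_floor (x i)

lemma measurable_cubeProj {d : ℕ} : Measurable (cubeProj (d := d)) :=
  measurable_pi_lambda _ fun i => measurable_fract.comp (measurable_pi_apply i)

lemma measurableSet_unitCube {d : ℕ} : MeasurableSet (unitCube d) := by
  have : unitCube d = Set.univ.pi fun _ => Set.Ico (0 : ℝ) 1 := by
    ext x; simp [unitCube]
  rw [this]
  exact MeasurableSet.univ_pi fun _ => measurableSet_Ico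

namespace ZdPeriodic

lemma comp_cubeProj {d : ℕ} {E : Type*} {f : (Fin d → ℝ) → E} (hf : ZdPeriodic f)
    (x : Fin d → ℝ) : f (cubeProj x) = f x := by
  conv_rhs => rw [← cubeProj_add_floor x]
  exact (hf _ _).symm

lemma comp_left {d : ℕ} {E G : Type*} {f : (Fin d → ℝ) → E} (hf : ZdPeriodic f) (φ : E → G) :
    ZdPeriodic fun x => φ (f x) :=
  fun κ x => congrArg φ (hf κ x)

lemma comp₂ {d : ℕ} {E E' G : Type*} {f : (Fin d → ℝ) → E} {g : (Fin d → ℝ) → E'}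
    (hf : ZdPeriodic f) (hg : ZdPeriodic g) (φ : E → E' → G) :
    ZdPeriodic fun x => φ (f x) (g x) :=
  fun κ x => congrArg₂ φ (hf κ x) (hg κ x)

lemma exists_norm_le {d : ℕ} {E : Type*} [NormedAddCommGroup E] {f : (Fin d → ℝ) → E}
    (hf : ZdPeriodic f) (hc : Continuous f) : ∃ C : ℝ, 0 ≤ C ∧ ∀ x, ‖f x‖ ≤ C := by
  obtain ⟨C, hC⟩ := (isCompact_Icc (a := (0 : Fin d → ℝ)) (b := 1)).exists_bound_of_continuousOn
    hc.continuousOn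
  have h : ∀ x, ‖f x‖ ≤ C := fun x => by
    rw [← hf.comp_cubeProj x]
    exact hC _ ⟨fun i => (cubeProj_mem_unitCube x i).1, fun i => (cubeProj_mem_unitCube x i).2.le⟩
  exact ⟨C, (norm_nonneg _).trans (h 0), h⟩

lemma integrable {d : ℕ} {E : Type*} [NormedAddCommGroup E] {f : (Fin d → ℝ) → E}
    (hf : ZdPeriodic f) (hc : Continuous f) (μ : Measure (Fin d → ℝ)) [IsFiniteMeasure μ]
    [SecondCountableTopology E] :
    Integrable f μ := by
  obtain ⟨C, -, hC⟩ := hf.exists_norm_le hc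
  exact Integrable.of_bound hc.aestronglyMeasurable C (Eventually.of_forall hC)

lemma fderiv {d : ℕ} {E : Type*} [NormedAddCommGroup E] [NormedSpace ℝ E]
    {f : (Fin d → ℝ) → E} (hf : ZdPeriodic f) : ZdPeriodic (fderiv ℝ f) := fun κ x => by
  rw [← fderiv_comp_add_right]
  congr 1
  exact funext fun y => hf κ y

lemma exists_lipschitzWith {d : ℕ} {E : Type*} [NormedAddCommGroup E] [NormedSpace ℝ E]
    {f : (Fin d → ℝ) → E} (hf : ZdPeriodic f) (hc : ContDiff ℝ 1 f) :
    ∃ K : NNReal, LipschitzWith K f := by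
  obtain ⟨C, hC0, hC⟩ := hf.fderiv.exists_norm_le (hc.continuous_fderiv one_ne_zero)
  exact ⟨⟨C, hC0⟩, lipschitzWith_of_nnnorm_fderiv_le (hc.differentiable one_ne_zero) hC⟩

open scoped Convolution in
/-- Continuous periodic functions are bounded pointwise limits of `C¹` periodic functions. -/
lemma exists_contDiff_tendsto {d : ℕ} {ψ : (Fin d → ℝ) → ℝ} (hψ : ZdPeriodic ψ)
    (hc : Continuous ψ) :
    ∃ (g : ℕ → (Fin d → ℝ) → ℝ) (C : ℝ), (∀ k, ContDiff ℝ 1 (g k)) ∧ (∀ k, ZdPeriodic (g k)) ∧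
      (∀ k x, ‖g k x‖ ≤ C) ∧ ∀ x, Tendsto (fun k => g k x) atTop (nhds (ψ x)) := by
  obtain ⟨C, hC0, hC⟩ := hψ.exists_norm_le hc
  let φ : ℕ → ContDiffBump (0 : Fin d → ℝ) := fun k =>
    ⟨1 / ((k : ℝ) + 1), 2 * (1 / ((k : ℝ) + 1)), by positivity, by
      have : 0 < 1 / ((k : ℝ) + 1) := by positivity
      linarith⟩
  refine ⟨fun k => (φ k).normed volume ⋆[ContinuousLinearMap.lsmul ℝ ℝ, volume] ψ, 2 * C + C,
    fun k => ?_, fun k κ x => ?_, fun k x => ?_, fun x => ?_⟩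
  · exact (φ k).hasCompactSupport_normed.contDiff_convolution_left (n := 1) _ (φ k).contDiff_normed
      hc.locallyIntegrable
  · simp only [convolution]
    congr 1
    ext t
    rw [add_sub_right_comm, hψ κ]
  · have := (φ k).dist_normed_convolution_le (μ := volume) (x₀ := x) (ε := 2 * C)
      hc.aestronglyMeasurable (fun y _ => by
        rw [dist_eq_norm]
        linarith [norm_sub_le (ψ y) (ψ x), hC x, hC y])
    rw [dist_eq_norm] at this
    have h2 := norm_sub_norm_le
      (((φ k).normed volume ⋆[ContinuousLinearMap.lsmul ℝ ℝ, volume] ψ) x) (ψ x)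
    linarith [hC x]
  · refine ContDiffBump.convolution_tendsto_right_of_continuous ?_ hc x
    have h := (tendsto_one_div_add_atTop_nhds_zero_nat (𝕜 := ℝ)).const_mul 2
    rwa [mul_zero] at h

end ZdPeriodic

/-- A finite measure on the unit cube is determined by the integrals of continuous periodic
functions. -/
lemma measure_ext_of_forall_integral_zdPeriodic {d : ℕ} {μ ν : Measure (Fin d → ℝ)}
    [IsFiniteMeasure μ] [IsFiniteMeasure ν] (hμ : μ (unitCube d)ᶜ = 0)
    (hν : ν (unitCube d)ᶜ = 0)
    (h : ∀ ψ : (Fin d → ℝ) → ℝ, Continuous ψ → ZdPeriodic ψ → ∫ y, ψ y ∂μ = ∫ y, ψ y ∂ν) :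
    μ = ν := by
  have : Fact ((0 : ℝ) < 1) := ⟨one_pos⟩
  let p : (Fin d → ℝ) → (Fin d → UnitAddCircle) := fun x i => (x i : UnitAddCircle)
  let s : (Fin d → UnitAddCircle) → (Fin d → ℝ) := fun θ i =>
    (AddCircle.measurableEquivIco 1 0 (θ i) : ℝ)
  have hp : Continuous p := continuous_pi fun i =>
    (AddCircle.continuous_mk' 1).comp (continuous_apply i)
  have hs : Measurable s := measurable_pi_lambda _ fun i =>
    measurable_subtype_coe.comp ((MeasurableEquiv.measurable _).comp (measurable_pi_apply i))
  have hsp : ∀ x ∈ unitCube d, s (p x) = x := fun x hx => funext fun i => by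
    have := (AddCircle.equivIco (1 : ℝ) 0).apply_symm_apply ⟨x i, by simpa using hx i⟩
    exact congrArg Subtype.val this
  have key : Measure.map p μ = Measure.map p ν := by
    refine ext_of_forall_integral_eq_of_IsFiniteMeasure fun f => ?_
    rw [integral_map hp.aemeasurable f.continuous.aestronglyMeasurable,
      integral_map hp.aemeasurable f.continuous.aestronglyMeasurable]
    refine h (fun x => f (p x)) (f.continuous.comp hp) fun κ x => ?_
    refine congrArg f (funext fun i => ?_)
    change ((x i + κ i : ℝ) : UnitAddCircle) = (x i : UnitAddCircle)
    have : (((κ i : ℤ) : ℝ) : UnitAddCircle) = 0 :=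
      (AddCircle.coe_eq_zero_iff 1).2 ⟨κ i, by simp⟩
    rw [AddCircle.coe_add, this, add_zero]
  have back : ∀ m : Measure (Fin d → ℝ), m (unitCube d)ᶜ = 0 →
      Measure.map s (Measure.map p m) = m := fun m hm => by
    rw [Measure.map_map hs hp.measurable]
    have : s ∘ p =ᵐ[m] id := by
      filter_upwards [measure_eq_zero_iff_ae_notMem.1 hm] with x hx
      exact hsp x (by simpa using hx)
    rw [Measure.map_congr this, Measure.map_id]
  rw [← back μ hμ, ← back ν hν, key]

namespace IsFlowOf

variable {d : ℕ} {b : (Fin d → ℝ) → (Fin d → ℝ)} {X : ℝ → (Fin d → ℝ) → (Fin d → ℝ)}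
  {K : NNReal}

lemma eq_of_hasDerivAt (hX : IsFlowOf b X) (hb : LipschitzWith K b) {γ : ℝ → Fin d → ℝ}
    (hγ : ∀ t, HasDerivAt γ (b (γ t)) t) (t : ℝ) : γ t = X t (γ 0) :=
  congrFun (ODE_solution_unique_univ (v := fun _ => b) (s := fun _ => Set.univ) (t₀ := 0)
    (fun _ => hb.lipschitzOnWith) (fun t => ⟨hγ t, trivial⟩)
    (fun t => ⟨(hX (γ 0)).2 t, trivial⟩) (hX (γ 0)).1.symm) t

lemma add_apply (hX : IsFlowOf b X) (hb : LipschitzWith K b) (s t : ℝ) (x : Fin d → ℝ) :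
    X (s + t) x = X s (X t x) := by
  have := hX.eq_of_hasDerivAt hb (γ := fun s => X (s + t) x)
    (fun s => ((hX x).2 (s + t)).comp_add_const s t) s
  simpa using this

lemma neg (hX : IsFlowOf b X) : IsFlowOf (fun x => -b x) (fun t => X (-t)) := fun x =>
  ⟨by simpa using (hX x).1, fun t => by
    have h := ((hX x).2 (-t)).scomp t (hasDerivAt_neg t)
    rw [neg_one_smul] at h
    exact h⟩

lemma apply_add_lattice (hX : IsFlowOf b X) (hb : LipschitzWith K b) (hper : ZdPeriodic b)
    (t : ℝ) (κ : Fin d → ℤ) (x : Fin d → ℝ) :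
    X t (x + fun i => (κ i : ℝ)) = X t x + fun i => (κ i : ℝ) := by
  have := hX.eq_of_hasDerivAt hb (γ := fun s => X s x + fun i => (κ i : ℝ))
    (fun s => by rw [hper κ]; exact ((hX x).2 s).add_const _) t
  simpa [(hX x).1] using this.symm

lemma zdPeriodic_comp (hX : IsFlowOf b X) (hb : LipschitzWith K b) (hper : ZdPeriodic b)
    {E : Type*} {ψ : (Fin d → ℝ) → E} (hψ : ZdPeriodic ψ) (t : ℝ) :
    ZdPeriodic fun x => ψ (X t x) := fun κ x => by
  simp only [hX.apply_add_lattice hb hper, hψ κ]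

lemma zdPeriodic_sub_self (hX : IsFlowOf b X) (hb : LipschitzWith K b) (hper : ZdPeriodic b)
    (t : ℝ) : ZdPeriodic fun x => X t x - x := fun κ x => by
  simp only [hX.apply_add_lattice hb hper, add_sub_add_right_eq_sub]

lemma exists_lipschitzWith_of_nonneg (hX : IsFlowOf b X) (hb : LipschitzWith K b) {t : ℝ}
    (ht : 0 ≤ t) : ∃ L : NNReal, LipschitzWith L (X t) := by
  refine ⟨⟨Real.exp (K * t), (Real.exp_pos _).le⟩, LipschitzWith.of_dist_le_mul fun x y => ?_⟩
  have := dist_le_of_trajectories_ODE (v := fun _ => b) (f := fun s => X s x)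
    (g := fun s => X s y) (a := 0) (b := t) (δ := dist x y) (fun _ => hb)
    (fun s _ => ((hX x).2 s).continuousAt.continuousWithinAt)
    (fun s _ => ((hX x).2 s).hasDerivWithinAt)
    (fun s _ => ((hX y).2 s).continuousAt.continuousWithinAt)
    (fun s _ => ((hX y).2 s).hasDerivWithinAt)
    (by simp only [(hX x).1, (hX y).1, le_refl]) t ⟨ht, le_rfl⟩
  rwa [sub_zero, mul_comm] at this

lemma exists_lipschitzWith (hX : IsFlowOf b X) (hb : LipschitzWith K b) (t : ℝ) :
    ∃ L : NNReal, LipschitzWith L (X t) := by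
  rcases le_total 0 t with ht | ht
  · exact hX.exists_lipschitzWith_of_nonneg hb ht
  · simpa using hX.neg.exists_lipschitzWith_of_nonneg hb.neg (neg_nonneg.2 ht)

lemma continuous (hX : IsFlowOf b X) (hb : LipschitzWith K b) (t : ℝ) : Continuous (X t) :=
  (hX.exists_lipschitzWith hb t).choose_spec.continuous

lemma lipschitzWith_time (hX : IsFlowOf b X) {C : NNReal} (hC : ∀ x, ‖b x‖ ≤ C)
    (x : Fin d → ℝ) : LipschitzWith C fun t => X t x :=
  lipschitzWith_of_nnnorm_deriv_le (fun t => ((hX x).2 t).differentiableAt) fun t => by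
    rw [((hX x).2 t).deriv]; exact hC _

lemma apply_eq_self_of_eq_zero (hX : IsFlowOf b X) (hb : LipschitzWith K b) {x : Fin d → ℝ}
    (hx : b x = 0) (t : ℝ) : X t x = x :=
  (hX.eq_of_hasDerivAt hb (γ := fun _ => x) (fun s => by rw [hx]; exact hasDerivAt_const s x)
    t).symm

lemma apply_neg_apply (hX : IsFlowOf b X) (hb : LipschitzWith K b) (t : ℝ) (x : Fin d → ℝ) :
    X (-t) (X t x) = x := by
  rw [← hX.add_apply hb, neg_add_cancel, (hX x).1]

lemma apply_eq_zero_iff (hX : IsFlowOf b X) (hb : LipschitzWith K b) (t : ℝ)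
    (x : Fin d → ℝ) : b (X t x) = 0 ↔ b x = 0 := by
  refine ⟨fun h => ?_, fun h => by rwa [hX.apply_eq_self_of_eq_zero hb h]⟩
  have h1 := hX.apply_neg_apply hb t x
  rw [hX.apply_eq_self_of_eq_zero hb h] at h1
  rwa [h1] at h

end IsFlowOf

/-- The integrals of a bounded `C¹` family with constant mean derivative grow linearly. -/
lemma integral_eq_add_mul_of_hasDerivAt {α : Type*} [MeasurableSpace α] {μ : Measure α}
    [IsFiniteMeasure μ] {F F' : ℝ → α → ℝ} {C c : ℝ} (hF : ∀ t, Integrable (F t) μ)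
    (hF' : ∀ t, AEStronglyMeasurable (F' t) μ) (hbound : ∀ t x, ‖F' t x‖ ≤ C)
    (hderiv : ∀ t x, HasDerivAt (fun s => F s x) (F' t x) t) (hc : ∀ t, ∫ x, F' t x ∂μ = c)
    (t : ℝ) : ∫ x, F t x ∂μ = ∫ x, F 0 x ∂μ + t * c := by
  have key : ∀ t, HasDerivAt (fun s => ∫ x, F s x ∂μ - s * c) 0 t := fun t => by
    have h := (hasDerivAt_integral_of_dominated_loc_of_deriv_le (μ := μ) (F := F) (F' := F')
      (x₀ := t) (s := Set.univ) (bound := fun _ => C) univ_mem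
      (Eventually.of_forall fun s => (hF s).aestronglyMeasurable) (hF t) (hF' t)
      (Eventually.of_forall fun x s _ => hbound s x) (integrable_const C)
      (Eventually.of_forall fun x s _ => hderiv s x)).2
    rw [hc t] at h
    have h2 := h.sub ((hasDerivAt_id t).mul_const c)
    rw [one_mul, sub_self] at h2
    exact h2
  have := is_const_of_deriv_eq_zero (fun t => (key t).differentiableAt)
    (fun t => (key t).deriv) t 0
  simp only [zero_mul, sub_zero] at this
  linarith

namespace FlowInvariant

variable {d : ℕ} {b : (Fin d → ℝ) → (Fin d → ℝ)} {X : ℝ → (Fin d → ℝ) → (Fin d → ℝ)}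
  {K : NNReal} {μ : Measure (Fin d → ℝ)} [IsFiniteMeasure μ]

/-- The map induced by the flow on the unit cube preserves an invariant measure. -/
lemma map_cubeProj (h : FlowInvariant X μ) (hμ : μ (unitCube d)ᶜ = 0) (hX : IsFlowOf b X)
    (hb : LipschitzWith K b) (t : ℝ) : μ.map (fun x => cubeProj (X t x)) = μ := by
  have hm : Measurable fun x => cubeProj (X t x) :=
    measurable_cubeProj.comp (hX.continuous hb t).measurable
  refine measure_ext_of_forall_integral_zdPeriodic ?_ hμ fun ψ hψ hper => ?_
  · rw [Measure.map_apply hm measurableSet_unitCube.compl]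
    convert measure_empty (μ := μ)
    ext x
    simpa using cubeProj_mem_unitCube (X t x)
  · rw [integral_map hm.aemeasurable hψ.aestronglyMeasurable, ← h t ψ hψ hper]
    simp only [hper.comp_cubeProj]

/-- Restricting an invariant measure to an invariant periodic set gives an invariant measure. -/
lemma restrict (h : FlowInvariant X μ) (hμ : μ (unitCube d)ᶜ = 0) (hX : IsFlowOf b X)
    (hb : LipschitzWith K b) {B : Set (Fin d → ℝ)} (hB : MeasurableSet B)
    (hflow : ∀ t x, X t x ∈ B ↔ x ∈ B) (hper : ZdPeriodic (· ∈ B)) :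
    FlowInvariant X (μ.restrict B) := fun t ψ hψ hψper => by
  have hm : Measurable fun x => cubeProj (X t x) :=
    measurable_cubeProj.comp (hX.continuous hb t).measurable
  rw [← integral_indicator hB, ← integral_indicator hB]
  conv_rhs => rw [← h.map_cubeProj hμ hX hb t]
  rw [integral_map hm.aemeasurable
    (hψ.stronglyMeasurable.indicator hB).aestronglyMeasurable]
  congr 1
  ext x
  have h1 : cubeProj (X t x) ∈ B ↔ x ∈ B := by
    rw [← hflow t x]
    exact iff_of_eq (hper.comp_cubeProj (X t x))
  by_cases hx : x ∈ B
  · rw [Set.indicator_of_mem hx, Set.indicator_of_mem (h1.2 hx), hψper.comp_cubeProj]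
  · rw [Set.indicator_of_notMem hx, Set.indicator_of_notMem (mt h1.1 hx)]

end FlowInvariant

/-- The maximum of `0` and the first `n` Birkhoff sums of `F` along `T`. -/
def birkhoffMax {α : Type*} (T : α → α) (F : α → ℝ) : ℕ → α → ℝ
  | 0 => fun _ => 0
  | n + 1 => fun x => max 0 (F x + birkhoffMax T F n (T x))

lemma birkhoffMax_nonneg {α : Type*} (T : α → α) (F : α → ℝ) (n : ℕ) (x : α) :
    0 ≤ birkhoffMax T F n x := by
  cases n with
  | zero => exact le_rfl
  | succ n => exact le_max_left _ _

lemma birkhoffMax_le_succ {α : Type*} (T : α → α) (F : α → ℝ) (n : ℕ) (x : α) :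
    birkhoffMax T F n x ≤ birkhoffMax T F (n + 1) x := by
  induction n generalizing x with
  | zero => exact birkhoffMax_nonneg T F 1 x
  | succ n ih => exact max_le_max le_rfl (add_le_add le_rfl (ih (T x)))

lemma birkhoffSum_le_birkhoffMax {α : Type*} (T : α → α) (F : α → ℝ) (n : ℕ) (x : α) :
    birkhoffSum T F n x ≤ birkhoffMax T F n x := by
  induction n generalizing x with
  | zero => simp [birkhoffMax]
  | succ n ih =>
    rw [birkhoffSum_succ']
    exact (add_le_add le_rfl (ih (T x))).trans (le_max_right _ _)

/-- Maximal ergodic theorem for continuous periodic functions. -/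
lemma integral_nonneg_of_exists_birkhoffSum_pos {d : ℕ} {μ : Measure (Fin d → ℝ)}
    [IsFiniteMeasure μ] {T : (Fin d → ℝ) → (Fin d → ℝ)} (hT : Continuous T)
    (hTper : ∀ ψ : (Fin d → ℝ) → ℝ, ZdPeriodic ψ → ZdPeriodic fun x => ψ (T x))
    (hinv : ∀ ψ : (Fin d → ℝ) → ℝ, Continuous ψ → ZdPeriodic ψ →
      ∫ y, ψ (T y) ∂μ = ∫ y, ψ y ∂μ)
    {F : (Fin d → ℝ) → ℝ} (hF : Continuous F) (hFper : ZdPeriodic F)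
    (hpos : ∀ᵐ x ∂μ, ∃ n, 0 < birkhoffSum T F n x) : 0 ≤ ∫ x, F x ∂μ := by
  have hM : ∀ n, Continuous (birkhoffMax T F n) ∧ ZdPeriodic (birkhoffMax T F n) := fun n => by
    induction n with
    | zero => exact ⟨continuous_const, fun _ _ => rfl⟩
    | succ n ih =>
      refine ⟨continuous_const.max (hF.add (ih.1.comp hT)), fun κ x => ?_⟩
      simp only [birkhoffMax]
      rw [hFper κ, show birkhoffMax T F n (T _) = _ from hTper _ ih.2 κ x]
  have hD : ∀ n x, birkhoffMax T F (n + 1) x - birkhoffMax T F n (T x) =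
      max (-birkhoffMax T F n (T x)) (F x) := fun n x => by
    rw [birkhoffMax, ← max_sub_sub_right, zero_sub, add_sub_cancel_right]
  have hint : ∀ n, 0 ≤ ∫ x, max (-birkhoffMax T F n (T x)) (F x) ∂μ := fun n => by
    simp only [← hD]
    rw [integral_sub ((hM _).2.integrable (hM _).1 μ)
      ((hTper _ (hM n).2).integrable ((hM n).1.comp hT) μ), hinv _ (hM n).1 (hM n).2, sub_nonneg]
    exact integral_mono ((hM _).2.integrable (hM _).1 μ) ((hM _).2.integrable (hM _).1 μ)
      fun x => birkhoffMax_le_succ T F n x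
  have hlim : Tendsto (fun n => ∫ x, max (-birkhoffMax T F n (T x)) (F x) ∂μ) atTop
      (nhds (∫ x, F x ∂μ)) := by
    refine tendsto_integral_of_dominated_convergence (fun x => |F x|)
      (fun n => (((hM n).1.comp hT).neg.max hF).aestronglyMeasurable)
      (hFper.integrable hF μ).abs (fun n => Eventually.of_forall fun x => ?_) ?_
    · have := birkhoffMax_nonneg T F n (T x)
      rw [Real.norm_eq_abs, abs_le]
      exact ⟨(neg_abs_le _).trans (le_max_right _ _),
        max_le (by linarith [abs_nonneg (F x)]) (le_abs_self _)⟩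
    · filter_upwards [hpos] with x ⟨n, hn⟩
      refine tendsto_const_nhds.congr' ?_
      filter_upwards [eventually_ge_atTop n] with m hm
      refine (max_eq_right ?_).symm
      cases n with
      | zero => simp at hn
      | succ n =>
        rw [birkhoffSum_succ'] at hn
        have h1 := birkhoffSum_le_birkhoffMax T F n (T x)
        have h2 : birkhoffMax T F n (T x) ≤ birkhoffMax T F m (T x) :=
          monotone_nat_of_le_succ (f := fun k => birkhoffMax T F k (T x))
            (fun k => birkhoffMax_le_succ T F k (T x)) (by omega)
        linarith
  exact ge_of_tendsto' hlim hint

/-- Time change: a function differentiable along the flow of `a` and Lipschitz is differentiable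
along the flow of `r • a`, with derivative multiplied by `r`. -/
lemma hasDerivAt_comp_of_timeChange {E : Type*} [NormedAddCommGroup E] [NormedSpace ℝ E]
    {g : E → ℝ} {L : NNReal} (hg : LipschitzWith L g) {x v : E} {r g' : ℝ} {γ γ₁ : ℝ → E}
    (hγ0 : γ 0 = x) (hγ : HasDerivAt γ (r • v) 0) (hγ₁0 : γ₁ 0 = x) (hγ₁ : HasDerivAt γ₁ v 0)
    (hg' : HasDerivAt (fun s => g (γ₁ s)) g' 0) :
    HasDerivAt (fun s => g (γ s)) (r * g') 0 := by
  have hmul : HasDerivAt (fun s : ℝ => r * s) r 0 := by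
    simpa using (hasDerivAt_id (0 : ℝ)).const_mul r
  have h1 : HasDerivAt (fun s => γ₁ (r * s)) (r • v) 0 :=
    HasDerivAt.scomp (h := fun s : ℝ => r * s) 0 (by simpa using hγ₁) hmul
  have h2 : HasDerivAt (fun s => g (γ₁ (r * s))) (r * g') 0 := by
    rw [mul_comm]
    exact HasDerivAt.comp (h := fun s : ℝ => r * s) (h₂ := fun s => g (γ₁ s)) 0
      (by simpa using hg') hmul
  have h3 : HasDerivAt (fun s => g (γ s) - g (γ₁ (r * s))) 0 0 := by
    have h := hγ.sub h1
    rw [sub_self, hasDerivAt_iff_isLittleO] at h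
    rw [hasDerivAt_iff_isLittleO]
    refine Asymptotics.IsBigO.trans_isLittleO (Asymptotics.IsBigO.of_bound L ?_) h
    refine Eventually.of_forall fun s => ?_
    simpa [hγ0, hγ₁0, dist_eq_norm] using hg.dist_le_mul (γ s) (γ₁ (r * s))
  have h4 := h3.add h2
  rw [zero_add] at h4
  refine h4.congr_of_eventuallyEq (Eventually.of_forall fun s => ?_)
  simp

namespace FlowInvariant

variable {d : ℕ} {a : (Fin d → ℝ) → (Fin d → ℝ)} {r : (Fin d → ℝ) → ℝ}
  {X Y : ℝ → (Fin d → ℝ) → (Fin d → ℝ)} {μ : Measure (Fin d → ℝ)} [IsFiniteMeasure μ]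

/-- If `μ` is invariant for the flow of `r • a`, then `r μ` is infinitesimally invariant for the
flow of `a`. -/
lemma integral_mul_fderiv_eq_zero (h : FlowInvariant X μ)
    (hr : Continuous r) (hrper : ZdPeriodic r) (ha : ContDiff ℝ 1 a) (haper : ZdPeriodic a)
    (hX : IsFlowOf (fun x => r x • a x) X) (hY : IsFlowOf a Y)
    {K : NNReal} (hb : LipschitzWith K fun x => r x • a x)
    {ψ : (Fin d → ℝ) → ℝ} (hψ : ContDiff ℝ 1 ψ) (hψper : ZdPeriodic ψ) (t : ℝ) :
    ∫ x, r x * fderiv ℝ ψ (Y t x) (a (Y t x)) ∂μ = 0 := by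
  obtain ⟨Ka, hKa⟩ := haper.exists_lipschitzWith ha
  obtain ⟨L₁, hL₁⟩ := hψper.exists_lipschitzWith hψ
  obtain ⟨L₂, hL₂⟩ := hY.exists_lipschitzWith hKa t
  have hbper : ZdPeriodic fun x => r x • a x := hrper.comp₂ haper (· • ·)
  obtain ⟨C, hC0, hC⟩ := hbper.exists_norm_le hb.continuous
  have hg : LipschitzWith (L₁ * L₂) fun x => ψ (Y t x) := hL₁.comp hL₂
  have hgper : ZdPeriodic fun x => ψ (Y t x) := hY.zdPeriodic_comp hKa haper hψper t
  have hderiv : ∀ x, HasDerivAt (fun s => ψ (Y t (X s x)))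
      (r x * fderiv ℝ ψ (Y t x) (a (Y t x))) 0 := fun x => by
    refine hasDerivAt_comp_of_timeChange (γ := fun s => X s x) (γ₁ := fun s => Y s x)
      (v := a x) hg (hX x).1 ?_ (hY x).1 ?_ ?_
    · simpa [(hX x).1] using (hX x).2 0
    · simpa [(hY x).1] using (hY x).2 0
    · simp only [← hY.add_apply hKa]
      have h1 : HasDerivAt (fun s => Y (t + s) x) (a (Y t x)) 0 := by
        simpa using HasDerivAt.comp_const_add (f := fun s => Y s x) t 0 ((hY x).2 (t + 0))
      refine HasFDerivAt.comp_hasDerivAt (l := ψ) (f := fun s => Y (t + s) x) 0 ?_ h1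
      simpa using ((hψ.differentiable one_ne_zero) (Y t x)).hasFDerivAt
  have hYc := hY.continuous hKa t
  have key := (hasDerivAt_integral_of_dominated_loc_of_lip (μ := μ)
    (F := fun s x => ψ (Y t (X s x))) (x₀ := 0) (s := Set.univ)
    (bound := fun _ => ((L₁ * L₂ * ⟨C, hC0⟩ : NNReal) : ℝ)) univ_mem
    (Eventually.of_forall fun s => (hg.continuous.comp (hX.continuous hb s)).aestronglyMeasurable)
    ((hX.zdPeriodic_comp hb hbper hgper 0).integrable (hg.continuous.comp (hX.continuous hb 0)) μ)
    (hr.mul (((hψ.continuous_fderiv one_ne_zero).comp hYc).clm_apply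
      (ha.continuous.comp hYc))).aestronglyMeasurable
    (Eventually.of_forall fun x => by
      rw [Real.nnabs_of_nonneg (NNReal.coe_nonneg _), Real.toNNReal_coe]
      exact (hg.comp (hX.lipschitzWith_time (C := ⟨C, hC0⟩) hC x)).lipschitzOnWith)
    (integrable_const _) (Eventually.of_forall hderiv)).2
  have hconst : (fun s => ∫ x, ψ (Y t (X s x)) ∂μ) = fun _ => ∫ x, ψ (Y t x) ∂μ :=
    funext fun s => h s _ hg.continuous hgper
  rw [hconst] at key
  exact key.unique (hasDerivAt_const _ _)

/-- If `μ` is invariant for the flow of `r • a`, then `r μ` is invariant for the flow of `a`. -/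
lemma integral_mul_comp (h : FlowInvariant X μ)
    (hr : Continuous r) (hrper : ZdPeriodic r) (ha : ContDiff ℝ 1 a) (haper : ZdPeriodic a)
    (hX : IsFlowOf (fun x => r x • a x) X) (hY : IsFlowOf a Y)
    {K : NNReal} (hb : LipschitzWith K fun x => r x • a x)
    {ψ : (Fin d → ℝ) → ℝ} (hψ : Continuous ψ) (hψper : ZdPeriodic ψ) (t : ℝ) :
    ∫ x, r x * ψ (Y t x) ∂μ = ∫ x, r x * ψ x ∂μ := by
  obtain ⟨Ka, hKa⟩ := haper.exists_lipschitzWith ha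
  obtain ⟨R, hR0, hR⟩ := hrper.exists_norm_le hr
  have smooth : ∀ g : (Fin d → ℝ) → ℝ, ContDiff ℝ 1 g → ZdPeriodic g →
      ∫ x, r x * g (Y t x) ∂μ = ∫ x, r x * g x ∂μ := fun g hg hgper => by
    have hdper : ZdPeriodic fun x => fderiv ℝ g x (a x) := hgper.fderiv.comp₂ haper (· ·)
    have hdc : Continuous fun x => fderiv ℝ g x (a x) :=
      (hg.continuous_fderiv one_ne_zero).clm_apply ha.continuous
    obtain ⟨C, hC0, hC⟩ := hdper.exists_norm_le hdc
    have := integral_eq_add_mul_of_hasDerivAt (μ := μ) (F := fun t x => r x * g (Y t x))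
      (F' := fun t x => r x * fderiv ℝ g (Y t x) (a (Y t x))) (C := R * C) (c := 0)
      (fun s => ZdPeriodic.integrable
        (hrper.comp₂ (hY.zdPeriodic_comp hKa haper hgper s) (· * ·))
        (hr.mul (hg.continuous.comp (hY.continuous hKa s))) μ)
      (fun s => (hr.mul (hdc.comp (hY.continuous hKa s))).aestronglyMeasurable)
      (fun s x => by
        rw [norm_mul]
        exact mul_le_mul (hR x) (hC _) (norm_nonneg _) hR0)
      (fun s x => ((hg.differentiable one_ne_zero _).hasFDerivAt.comp_hasDerivAt s
        ((hY x).2 s)).const_mul (r x))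
      (fun s => h.integral_mul_fderiv_eq_zero hr hrper ha haper hX hY hb hg hgper s) t
    simpa [(hY _).1] using this
  obtain ⟨g, C, hg, hgper, hgC, hlim⟩ := hψper.exists_contDiff_tendsto hψ
  have lim : ∀ T : (Fin d → ℝ) → (Fin d → ℝ), Continuous T →
      Tendsto (fun k => ∫ x, r x * g k (T x) ∂μ) atTop (nhds (∫ x, r x * ψ (T x) ∂μ)) :=
    fun T hT => tendsto_integral_of_dominated_convergence (fun _ => R * C)
      (fun k => (hr.mul ((hg k).continuous.comp hT)).aestronglyMeasurable) (integrable_const _)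
      (fun k => Eventually.of_forall fun x => by
        rw [norm_mul]
        exact mul_le_mul (hR x) (hgC k _) (norm_nonneg _) hR0)
      (Eventually.of_forall fun x => (hlim (T x)).const_mul (r x))
  refine tendsto_nhds_unique (lim (Y t) (hY.continuous hKa t)) ?_
  simpa only [smooth _ (hg _) (hgper _), id] using lim id continuous_id

/-- The integral of the velocity is the mean displacement in unit time. -/
lemma integral_displacement {b : (Fin d → ℝ) → (Fin d → ℝ)} (h : FlowInvariant X μ)
    (hX : IsFlowOf b X) {K : NNReal} (hb : LipschitzWith K b) (hbper : ZdPeriodic b)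
    (ℓ : (Fin d → ℝ) →L[ℝ] ℝ) :
    ∫ x, ℓ (X 1 x - x) ∂μ = ℓ (∫ x, b x ∂μ) := by
  have hper : ZdPeriodic fun x => ℓ (b x) := hbper.comp_left ℓ
  obtain ⟨C, hC0, hC⟩ := hper.exists_norm_le (ℓ.continuous.comp hb.continuous)
  have := integral_eq_add_mul_of_hasDerivAt (μ := μ) (F := fun t x => ℓ (X t x - x))
    (F' := fun t x => ℓ (b (X t x))) (C := C) (c := ∫ x, ℓ (b x) ∂μ)
    (fun s => ((hX.zdPeriodic_sub_self hb hbper s).comp_left ℓ).integrable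
      (ℓ.continuous.comp ((hX.continuous hb s).sub continuous_id)) μ)
    (fun s => (ℓ.continuous.comp (hb.continuous.comp (hX.continuous hb s))).aestronglyMeasurable)
    (fun s x => hC _)
    (fun s x => ℓ.hasFDerivAt.comp_hasDerivAt s (((hX x).2 s).sub_const x))
    (fun s => h s _ (ℓ.continuous.comp hb.continuous) hper) 1
  rw [← ℓ.integral_comp_comm (hbper.integrable hb.continuous μ)]
  simpa [(hX _).1] using this

end FlowInvariant

namespace FlowInvariant

variable {d : ℕ} {X : ℝ → (Fin d → ℝ) → (Fin d → ℝ)} {μ : Measure (Fin d → ℝ)}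
  [IsFiniteMeasure μ]

/-- If the rotation set of `a` is a singleton `{z}`, then the mean velocity of any invariant measure
of the slowed-down field `r • a` is a multiple of `z`. -/
lemma integral_smul_eq_of_rotationSet_eq_singleton {a : (Fin d → ℝ) → (Fin d → ℝ)}
    {r : (Fin d → ℝ) → ℝ} {Y : ℝ → (Fin d → ℝ) → (Fin d → ℝ)} (h : FlowInvariant X μ)
    (hμ : μ (unitCube d)ᶜ = 0) (hr : Continuous r) (hrper : ZdPeriodic r) (hr0 : ∀ x, 0 ≤ r x)
    (ha : ContDiff ℝ 1 a) (haper : ZdPeriodic a)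
    (hX : IsFlowOf (fun x => r x • a x) X) (hY : IsFlowOf a Y)
    {K : NNReal} (hb : LipschitzWith K fun x => r x • a x) {z : Fin d → ℝ}
    (hz : rotationSet a Y = {z}) :
    ∫ x, r x • a x ∂μ = (∫ x, r x ∂μ) • z := by
  have hrint := hrper.integrable hr μ
  set c := ∫ x, r x ∂μ with hc
  rcases eq_or_ne c 0 with hc0 | hc0
  · rw [hc0, zero_smul]
    refine integral_eq_zero_of_ae ?_
    filter_upwards [(integral_eq_zero_iff_of_nonneg hr0 hrint).1 (hc.symm.trans hc0)] with x hx
    simp [hx]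
  have hcpos : 0 < c := (integral_nonneg hr0).lt_of_ne' hc0
  have hm : Measurable fun x => ENNReal.ofReal (r x / c) :=
    (hr.measurable.div_const c).ennreal_ofReal
  have hint : ∀ {G : Type} [NormedAddCommGroup G] [NormedSpace ℝ G] (f : (Fin d → ℝ) → G),
      ∫ x, f x ∂μ.withDensity (fun x => ENNReal.ofReal (r x / c)) = c⁻¹ • ∫ x, r x • f x ∂μ := by
    intro G _ _ f
    rw [integral_withDensity_eq_integral_toReal_smul hm (by simp), ← integral_smul]
    congr 1
    ext x
    rw [ENNReal.toReal_ofReal (div_nonneg (hr0 x) hcpos.le), smul_smul, div_eq_inv_mul]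
  have hmem : c⁻¹ • ∫ x, r x • a x ∂μ ∈ rotationSet a Y := by
    refine ⟨μ.withDensity (fun x => ENNReal.ofReal (r x / c)), ⟨?_⟩,
      withDensity_absolutelyContinuous _ _ hμ, fun t ψ hψ hψper => ?_, (hint a).symm⟩
    · rw [withDensity_apply _ MeasurableSet.univ, Measure.restrict_univ,
        ← ofReal_integral_eq_lintegral_ofReal (hrint.div_const c)
          (Eventually.of_forall fun x => div_nonneg (hr0 x) hcpos.le), integral_div, ← hc,
        div_self hc0, ENNReal.ofReal_one]
    · rw [hint, hint]
      simp only [smul_eq_mul]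
      rw [h.integral_mul_comp hr hrper ha haper hX hY hb hψ hψper]
  rw [hz, Set.mem_singleton_iff] at hmem
  rw [← hmem, smul_smul, mul_inv_cancel₀ hc0, one_smul]

/-- If all invariant measures carried by an invariant set `P` have mean velocity `ζ`, then
almost every orbit in `P` drifts with linear speed at most `ℓ ζ` in the direction `ℓ`. -/
lemma ae_exists_forall_apply_le {b : (Fin d → ℝ) → (Fin d → ℝ)} (h : FlowInvariant X μ)
    (hμ : μ (unitCube d)ᶜ = 0) (hX : IsFlowOf b X) {K : NNReal} (hb : LipschitzWith K b)
    (hbper : ZdPeriodic b) {P : Set (Fin d → ℝ)} (hP : MeasurableSet P)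
    (hPflow : ∀ t x, X t x ∈ P ↔ x ∈ P) (hPper : ZdPeriodic (· ∈ P)) {ζ : Fin d → ℝ}
    (hζ : ∀ ν : Measure (Fin d → ℝ), IsFiniteMeasure ν → ν (unitCube d)ᶜ = 0 →
      FlowInvariant X ν → (∀ᵐ x ∂ν, x ∈ P) → ∫ x, b x ∂ν = ν.real Set.univ • ζ)
    (ℓ : (Fin d → ℝ) →L[ℝ] ℝ) {ε : ℝ} (hε : 0 < ε) :
    ∀ᵐ x ∂μ, x ∈ P → ∃ C : ℝ, ∀ n : ℕ, ℓ (X n x) ≤ n * (ℓ ζ + ε) + C := by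
  obtain ⟨C, hC0, hC⟩ := hbper.exists_norm_le hb.continuous
  let U : Set (Fin d → ℝ) := {x | ∀ k : ℕ, ∃ n : ℕ, (k : ℝ) < ℓ (X n x) - n * (ℓ ζ + ε)}
  have hUmono : ∀ {x y : Fin d → ℝ} (D : ℝ), (∀ n : ℕ, ‖X n x - X n y‖ ≤ D) →
      x ∈ U → y ∈ U := by
    intro x y D hD hx k
    obtain ⟨n, hn⟩ := hx (k + ⌈‖ℓ‖ * D⌉₊)
    refine ⟨n, ?_⟩
    have h1 : ℓ (X n x) - ℓ (X n y) ≤ ‖ℓ‖ * D := by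
      rw [← map_sub]
      exact (le_abs_self _).trans ((ℓ.le_opNorm _).trans
        (mul_le_mul_of_nonneg_left (hD n) (norm_nonneg _)))
    have h2 := Nat.le_ceil (‖ℓ‖ * D)
    push_cast at hn
    linarith
  have hUflow : ∀ t x, X t x ∈ U ↔ x ∈ U := fun t x => by
    have hd : ∀ n : ℕ, ‖X n (X t x) - X n x‖ ≤ C * |t| := fun n => by
      rw [← hX.add_apply hb]
      have := (hX.lipschitzWith_time (C := ⟨C, hC0⟩) hC x).dist_le_mul ((n : ℝ) + t) n
      rwa [dist_eq_norm, Real.dist_eq, add_sub_cancel_left] at this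
    exact ⟨hUmono _ hd, hUmono _ fun n => by rw [norm_sub_rev]; exact hd n⟩
  have hUper : ZdPeriodic (· ∈ U) := fun κ x => by
    have hd : ∀ n : ℕ, ‖X n (x + fun i => (κ i : ℝ)) - X n x‖ ≤ ‖fun i => (κ i : ℝ)‖ := fun n => by
      rw [hX.apply_add_lattice hb hbper, add_sub_cancel_left]
    exact propext ⟨hUmono _ hd, hUmono _ fun n => by rw [norm_sub_rev]; exact hd n⟩
  have hU : MeasurableSet U := by
    simp only [U, Set.ofPred_forall, Set.ofPred_exists]
    refine MeasurableSet.iInter fun k => MeasurableSet.iUnion fun n => ?_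
    exact (isOpen_lt continuous_const
      ((ℓ.continuous.comp (hX.continuous hb n)).sub continuous_const)).measurableSet
  have hB : MeasurableSet (P ∩ U) := hP.inter hU
  let F : (Fin d → ℝ) → ℝ := fun x => ℓ (X 1 x - x) - (ℓ ζ + ε)
  have hsub := (hX.zdPeriodic_sub_self hb hbper 1).comp_left ℓ
  have hsubc : Continuous fun x => ℓ (X 1 x - x) :=
    ℓ.continuous.comp ((hX.continuous hb 1).sub continuous_id)
  have hiter : ∀ (n : ℕ) (x : Fin d → ℝ), (X 1)^[n] x = X n x := fun n x => by
    induction n with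
    | zero => simp [(hX x).1]
    | succ n ih =>
      rw [Function.iterate_succ_apply', ih, ← hX.add_apply hb, Nat.cast_succ, add_comm]
  have hsum : ∀ (n : ℕ) (x : Fin d → ℝ),
      birkhoffSum (X 1) F n x = ℓ (X n x) - ℓ x - n * (ℓ ζ + ε) := fun n x => by
    induction n with
    | zero => simp [(hX x).1]
    | succ n ih =>
      rw [birkhoffSum_succ, ih, hiter]
      simp only [F]
      rw [← hX.add_apply hb, map_sub, Nat.cast_succ, add_comm 1 (n : ℝ)]
      ring
  have hinv : FlowInvariant X (μ.restrict (P ∩ U)) :=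
    h.restrict hμ hX hb hB (fun t x => and_congr (hPflow t x) (hUflow t x))
      (hPper.comp₂ hUper And)
  have hcube : μ.restrict (P ∩ U) (unitCube d)ᶜ = 0 :=
    Measure.absolutelyContinuous_of_le Measure.restrict_le_self hμ
  have hnonneg : 0 ≤ ∫ x, F x ∂μ.restrict (P ∩ U) := by
    refine integral_nonneg_of_exists_birkhoffSum_pos (hX.continuous hb 1)
      (fun ψ hψ => hX.zdPeriodic_comp hb hbper hψ 1) (hinv 1) (hsubc.sub continuous_const)
      (hsub.comp_left (· - (ℓ ζ + ε))) ?_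
    filter_upwards [ae_restrict_mem hB] with x hx
    obtain ⟨n, hn⟩ := hx.2 ⌈ℓ x⌉₊
    refine ⟨n, ?_⟩
    rw [hsum]
    linarith [Nat.le_ceil (ℓ x)]
  rw [integral_sub (hsub.integrable hsubc _) (integrable_const _),
    hinv.integral_displacement hX hb hbper,
    hζ _ inferInstance hcube hinv ((ae_restrict_mem hB).mono fun x hx => hx.1),
    integral_const, map_smul, smul_eq_mul, smul_eq_mul] at hnonneg
  have hzero : μ (P ∩ U) = 0 := by
    have h0 : (μ.restrict (P ∩ U)).real Set.univ = 0 := by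
      have := measureReal_nonneg (μ := μ.restrict (P ∩ U)) (s := Set.univ)
      nlinarith
    rw [measureReal_restrict_apply_univ] at h0
    exact (measureReal_eq_zero_iff).1 h0
  filter_upwards [measure_eq_zero_iff_ae_notMem.1 hzero] with x hx hxP
  by_contra! hcon
  refine hx ⟨hxP, fun k => ?_⟩
  obtain ⟨n, hn⟩ := hcon k
  exact ⟨n, by linarith⟩

end FlowInvariant

/-- A real function with upper and lower linear growth rate `z` satisfies `f t / t → z`. -/
lemma tendsto_inv_mul_of_forall_exists_le {f : ℝ → ℝ} {z : ℝ}
    (hu : ∀ k : ℕ, ∃ C : ℝ, ∀ t, 0 ≤ t → f t ≤ t * (z + 1 / ((k : ℝ) + 1)) + C)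
    (hl : ∀ k : ℕ, ∃ C : ℝ, ∀ t, 0 ≤ t → -f t ≤ t * (-z + 1 / ((k : ℝ) + 1)) + C) :
    Tendsto (fun t => t⁻¹ * f t) atTop (nhds z) := by
  rw [Metric.tendsto_atTop]
  intro ε hε
  obtain ⟨k, hk⟩ := exists_nat_one_div_lt (half_pos hε)
  obtain ⟨C₁, h₁⟩ := hu k
  obtain ⟨C₂, h₂⟩ := hl k
  refine ⟨max 1 (2 * (|C₁| + |C₂|) / ε), fun t ht => ?_⟩
  have ht1 : 1 ≤ t := (le_max_left _ _).trans ht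
  have htpos : 0 < t := by linarith
  have htC : 2 * (|C₁| + |C₂|) ≤ t * ε := (div_le_iff₀ hε).1 ((le_max_right _ _).trans ht)
  have hkt : t * (1 / ((k : ℝ) + 1)) < t * (ε / 2) := mul_lt_mul_of_pos_left hk htpos
  have e : t⁻¹ * f t - z = t⁻¹ * (f t - t * z) := by field_simp
  rw [Real.dist_eq, e, abs_mul, abs_of_pos (inv_pos.2 htpos), inv_mul_lt_iff₀ htpos, abs_lt]
  have a₁ := h₁ t htpos.le
  have a₂ := h₂ t htpos.le
  rw [mul_add] at a₁ a₂
  constructor <;> linarith [le_abs_self C₁, le_abs_self C₂, abs_nonneg C₁, abs_nonneg C₂]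

namespace IsFlowOf

/-- Linear bounds at integer times extend to all nonnegative times. -/
lemma exists_forall_apply_le_of_nat {d : ℕ} {b : (Fin d → ℝ) → (Fin d → ℝ)}
    {X : ℝ → (Fin d → ℝ) → (Fin d → ℝ)} (hX : IsFlowOf b X) {D : NNReal} (hD : ∀ x, ‖b x‖ ≤ D)
    (ℓ : (Fin d → ℝ) →L[ℝ] ℝ) {x : Fin d → ℝ} {z C : ℝ}
    (hC : ∀ n : ℕ, ℓ (X n x) ≤ n * z + C) :
    ∃ C' : ℝ, ∀ t, 0 ≤ t → ℓ (X t x) ≤ t * z + C' := by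
  refine ⟨C + |z| + ‖ℓ‖ * D, fun t ht => ?_⟩
  have h0 := Nat.floor_le ht
  have h1 := (Nat.lt_floor_add_one t).le
  have h2 : ℓ (X t x) - ℓ (X ⌊t⌋₊ x) ≤ ‖ℓ‖ * D := by
    rw [← map_sub]
    refine (le_abs_self _).trans ((ℓ.le_opNorm _).trans
      (mul_le_mul_of_nonneg_left ?_ (norm_nonneg _)))
    have h3 := (hX.lipschitzWith_time hD x).dist_le_mul t ⌊t⌋₊
    rw [dist_eq_norm, Real.dist_eq, abs_of_nonneg (by linarith)] at h3
    exact h3.trans (mul_le_of_le_one_right D.coe_nonneg (by linarith))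
  have h4 : (⌊t⌋₊ : ℝ) * z ≤ t * z + |z| := by
    have : ((⌊t⌋₊ : ℝ) - t) * z ≤ 1 * |z| :=
      (le_abs_self _).trans (by
        rw [abs_mul]
        exact mul_le_mul_of_nonneg_right (abs_le.2 ⟨by linarith, by linarith⟩) (abs_nonneg z))
    linarith
  linarith [hC ⌊t⌋₊]

end IsFlowOf

/-- In the setting of the perturbation theorem with `ρ` vanishing somewhere
and `ζ := lim ζ_n`, for every invariant probability measure `μ` with `∫ b dμ ≠ 0`, one has
`X(t,x)/t → ζ` for `μ`-almost every `x` in `{ρ > 0}`. -/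
theorem flow_asymptotics_ae_on_positivity_set {d : ℕ} (hd : 1 ≤ d)
    (ρ : (Fin d → ℝ) → ℝ) (hρ : ContDiff ℝ 1 ρ) (hρper : ZdPeriodic ρ)
    (hρ0 : ∀ y, 0 ≤ ρ y) (hρne : ∃ y, ρ y ≠ 0)
    (Φ : (Fin d → ℝ) → (Fin d → ℝ)) (hΦ : ContDiff ℝ 1 Φ) (hΦper : ZdPeriodic Φ)
    (hΦne : ∀ y, Φ y ≠ 0)
    (X : ℝ → (Fin d → ℝ) → (Fin d → ℝ)) (hX : IsFlowOf (fun y => ρ y • Φ y) X)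
    (ρn : ℕ → (Fin d → ℝ) → ℝ)
    (hρn : ∀ n, ContDiff ℝ 1 (ρn n)) (hρnper : ∀ n, ZdPeriodic (ρn n))
    (hρnpos : ∀ n y, 0 < ρn n y) (hle : ∀ n y, ρ y ≤ ρn n y)
    (hunif : TendstoUniformly ρn ρ atTop)
    (Xn : ℕ → ℝ → (Fin d → ℝ) → (Fin d → ℝ))
    (hXn : ∀ n, IsFlowOf (fun y => ρn n y • Φ y) (Xn n))
    (ζn : ℕ → Fin d → ℝ)
    (hsin : ∀ n, rotationSet (fun y => ρn n y • Φ y) (Xn n) = {ζn n})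
    (hvan : ∃ x₀, ρ x₀ = 0)
    (ζ : Fin d → ℝ) (hζ : Tendsto ζn atTop (nhds ζ)) :
    ∀ μ : Measure (Fin d → ℝ), IsProbabilityMeasure μ → μ (unitCube d)ᶜ = 0 →
      FlowInvariant X μ → (∫ y, ρ y • Φ y ∂μ) ≠ 0 →
        ∀ᵐ x ∂μ, 0 < ρ x →
          Tendsto (fun t : ℝ => t⁻¹ • X t x) atTop (nhds ζ) := by
  intro μ _ hμ hinv _
  have hbC : ContDiff ℝ 1 fun y => ρ y • Φ y := hρ.smul hΦ
  have hbper : ZdPeriodic fun y => ρ y • Φ y := hρper.comp₂ hΦper (· • ·)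
  obtain ⟨K, hb⟩ := hbper.exists_lipschitzWith hbC
  obtain ⟨D, hD0, hD⟩ := hbper.exists_norm_le hb.continuous
  have hflow : ∀ t x, X t x ∈ {x | 0 < ρ x} ↔ x ∈ {x | 0 < ρ x} := fun t x => by
    have h := hX.apply_eq_zero_iff hb t x
    simp only [smul_eq_zero, hΦne, or_false] at h
    simp only [Set.mem_ofPred_eq, (hρ0 _).lt_iff_ne', ne_eq, h]
  have hmean : ∀ ν : Measure (Fin d → ℝ), IsFiniteMeasure ν → ν (unitCube d)ᶜ = 0 →
      FlowInvariant X ν → (∀ᵐ x ∂ν, x ∈ {x | 0 < ρ x}) →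
      ∫ x, ρ x • Φ x ∂ν = ν.real Set.univ • ζ := fun ν _ hν hνinv hνpos => by
    have hr : ∀ n, Continuous fun x => ρ x / ρn n x := fun n =>
      hρ.continuous.div (hρn n).continuous fun x => (hρnpos n x).ne'
    have hra : ∀ n, (fun x => ρ x • Φ x) = fun x => (ρ x / ρn n x) • ρn n x • Φ x := fun n =>
      funext fun x => by rw [smul_smul, div_mul_cancel₀ _ (hρnpos n x).ne']
    have heq : ∀ n, ∫ x, ρ x • Φ x ∂ν = (∫ x, ρ x / ρn n x ∂ν) • ζn n := fun n => by
      rw [hra n]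
      exact hνinv.integral_smul_eq_of_rotationSet_eq_singleton hν (hr n)
        (hρper.comp₂ (hρnper n) (· / ·)) (fun x => div_nonneg (hρ0 x) (hρnpos n x).le)
        ((hρn n).smul hΦ) ((hρnper n).comp₂ hΦper (· • ·)) (hra n ▸ hX) (hXn n) (hra n ▸ hb)
        (hsin n)
    have hlim : Tendsto (fun n => ∫ x, ρ x / ρn n x ∂ν) atTop (nhds (∫ _, (1 : ℝ) ∂ν)) := by
      refine tendsto_integral_of_dominated_convergence (fun _ => 1)
        (fun n => (hr n).aestronglyMeasurable) (integrable_const _)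
        (fun n => Eventually.of_forall fun x => ?_) ?_
      · rw [Real.norm_eq_abs, abs_of_nonneg (div_nonneg (hρ0 x) (hρnpos n x).le)]
        exact div_le_one_of_le₀ (hle n x) (hρnpos n x).le
      · filter_upwards [hνpos] with x hx
        have := (tendsto_const_nhds (x := ρ x)).div (hunif.tendsto_at x) (ne_of_gt hx)
        rwa [div_self (ne_of_gt hx)] at this
    rw [integral_const, smul_eq_mul, mul_one] at hlim
    refine tendsto_nhds_unique (tendsto_const_nhds (f := atTop (α := ℕ))) ?_
    simpa only [← heq] using hlim.smul hζ
  have hbound : ∀ ℓ : (Fin d → ℝ) →L[ℝ] ℝ, ∀ᵐ x ∂μ, 0 < ρ x → ∀ k : ℕ,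
      ∃ C : ℝ, ∀ t, 0 ≤ t → ℓ (X t x) ≤ t * (ℓ ζ + 1 / ((k : ℝ) + 1)) + C := fun ℓ => by
    have hall := ae_all_iff.2 fun k : ℕ =>
      hinv.ae_exists_forall_apply_le hμ hX hb hbper
        (isOpen_lt continuous_const hρ.continuous).measurableSet hflow
        (hρper.comp_left (0 < ·)) hmean ℓ (ε := 1 / ((k : ℝ) + 1)) (by positivity)
    filter_upwards [hall] with x hx hpos k
    obtain ⟨C, hC⟩ := hx k hpos
    exact hX.exists_forall_apply_le_of_nat (D := ⟨D, hD0⟩) hD ℓ hC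
  have hcoord := ae_all_iff.2 fun i : Fin d =>
    (hbound (ContinuousLinearMap.proj i)).and (hbound (-ContinuousLinearMap.proj i))
  filter_upwards [hcoord] with x hx hpos
  rw [tendsto_pi_nhds]
  exact fun i => tendsto_inv_mul_of_forall_exists_le (f := fun t => X t x i)
    ((hx i).1 hpos) ((hx i).2 hpos)
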